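/- arXiv:2006.00282 — 2 statements merged into one kernel-verified Lean document; each statement's English description precedes it below -/
import Mathlib

section
/- Suppose ψ(Φ) = r + q for some Φ > 1 − ρ, where r, q > 0. Then the jump-gap integral at the threshold b̲ satisfies the explicit identity f(b̲) = (e^{(1−ρ)b̲}/(1−ρ))·(r + q − ψ(1−ρ)) − (r+q)/(1−ρ) − ½σ²Φ. -/
open MeasureTheory

/-- CRRA utility evaluated at `e^x`: `U(e^x) = (e^{(1−ρ)x} − 1)/(1−ρ)`. -/
noncomputable def Ue (ρ x : ℝ) : ℝ := (Real.exp ((1 - ρ) * x) - 1) / (1 - ρ)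

/-- The take-profit threshold `b̲ = (1/(1−ρ)) log(Φ/(Φ−1+ρ))`. -/
noncomputable def bLow (ρ Φ : ℝ) : ℝ := (1 / (1 - ρ)) * Real.log (Φ / (Φ - 1 + ρ))

/-- The value function `v̲(x) = e^{Φ(x−b̲)} U(e^{b̲})` for `x ≤ b̲`, and `U(e^x)` for `x > b̲`. -/
noncomputable def vLow (ρ Φ x : ℝ) : ℝ :=
  if x ≤ bLow ρ Φ then Real.exp (Φ * (x - bLow ρ Φ)) * Ue ρ (bLow ρ Φ) else Ue ρ x

/-- The jump-gap integral `f(x) = ∫_{(−∞,0)} (v̲(x+w) − U(e^{x+w})) ν(dw)`, where `ν` is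
the Lévy measure (denoted Π in the paper). -/
noncomputable def fGap (ρ Φ : ℝ) (ν : Measure ℝ) (x : ℝ) : ℝ :=
  ∫ w in Set.Iio (0 : ℝ), (vLow ρ Φ (x + w) - Ue ρ (x + w)) ∂ν

/-- The Laplace exponent of a spectrally negative Lévy process with triplet (μ, σ², ν):
`ψ(β) = μβ + ½σ²β² + ∫_{(−∞,0)} (e^{βw} − 1 − βw·1_{(−1,0)}(w)) ν(dw)`. -/
noncomputable def laplaceExponent (μ σ : ℝ) (ν : Measure ℝ) (β : ℝ) : ℝ :=
  μ * β + σ ^ 2 * β ^ 2 / 2 +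
    ∫ w in Set.Iio (0 : ℝ),
      (Real.exp (β * w) - 1 - (if w ∈ Set.Ioo (-1 : ℝ) 0 then β * w else 0)) ∂ν

lemma Real.exp_le_one_add_add_sq_of_nonpos {y : ℝ} (hy : y ≤ 0) :
    Real.exp y ≤ 1 + y + y ^ 2 := by
  have h := Real.quadratic_le_exp_of_nonneg (neg_nonneg.2 hy)
  have hmul : Real.exp y * Real.exp (-y) = 1 := by rw [← Real.exp_add]; simp
  have hpos : 0 < 1 + -y + (-y) ^ 2 / 2 := by nlinarith [sq_nonneg y]
  have hle : Real.exp y * (1 + -y + (-y) ^ 2 / 2) ≤ 1 :=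
    (mul_le_mul_of_nonneg_left h (Real.exp_pos y).le).trans_eq hmul
  have hge : 1 ≤ (1 + y + y ^ 2) * (1 + -y + (-y) ^ 2 / 2) := by
    nlinarith [sq_nonneg y, sq_nonneg (y ^ 2), mul_nonneg (sq_nonneg y) (neg_nonneg.2 hy)]
  exact le_of_mul_le_mul_right (hle.trans hge) hpos

lemma integrableOn_laplaceExponent_integrand {ν : Measure ℝ}
    (hν : IntegrableOn (fun w => min 1 (w ^ 2)) (Set.Iio (0 : ℝ)) ν) {β : ℝ} (hβ : 0 ≤ β) :
    IntegrableOn (fun w => Real.exp (β * w) - 1 -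
      (if w ∈ Set.Ioo (-1 : ℝ) 0 then β * w else 0)) (Set.Iio (0 : ℝ)) ν := by
  refine (hν.const_mul (1 + β ^ 2)).mono' ?_ ?_
  · refine Measurable.aestronglyMeasurable ?_
    exact (by fun_prop : Measurable fun w : ℝ => Real.exp (β * w) - 1).sub
      (Measurable.ite measurableSet_Ioo (by fun_prop) measurable_const)
  · filter_upwards [ae_restrict_mem measurableSet_Iio] with w hw
    have hw : w < 0 := hw
    have hy : β * w ≤ 0 := mul_nonpos_of_nonneg_of_nonpos hβ hw.le
    rw [Real.norm_eq_abs, abs_le]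
    by_cases h : -1 < w
    · rw [if_pos ⟨h, hw⟩, min_eq_right (by nlinarith)]
      have h1 := Real.add_one_le_exp (β * w)
      have h2 := Real.exp_le_one_add_add_sq_of_nonpos hy
      constructor <;> nlinarith [sq_nonneg w, sq_nonneg (β * w)]
    · rw [if_neg fun h' => h h'.1, min_eq_left (by nlinarith)]
      have h1 := Real.exp_pos (β * w)
      have h2 := Real.exp_le_one_iff.2 hy
      constructor <;> nlinarith [sq_nonneg β]

lemma exp_mul_bLow {ρ Φ : ℝ} (hρ : ρ < 1) (hΦ : 1 - ρ < Φ) :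
    Real.exp ((1 - ρ) * bLow ρ Φ) = Φ / (Φ - 1 + ρ) := by
  have ha : 1 - ρ ≠ 0 := by linarith
  rw [bLow, ← mul_assoc, mul_one_div_cancel ha, one_mul,
    Real.exp_log (div_pos (by linarith) (by linarith))]

lemma vLow_sub_Ue_bLow_add {ρ Φ w : ℝ} (hρ : ρ < 1) (hΦ : 1 - ρ < Φ) (hw : w < 0) :
    vLow ρ Φ (bLow ρ Φ + w) - Ue ρ (bLow ρ Φ + w) =
      1 / (Φ - 1 + ρ) * (Real.exp (Φ * w) - 1 -
        (if w ∈ Set.Ioo (-1 : ℝ) 0 then Φ * w else 0)) -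
      Φ / (Φ - 1 + ρ) / (1 - ρ) * (Real.exp ((1 - ρ) * w) - 1 -
        (if w ∈ Set.Ioo (-1 : ℝ) 0 then (1 - ρ) * w else 0)) := by
  have ha : 1 - ρ ≠ 0 := by linarith
  have hd : Φ - 1 + ρ ≠ 0 := by linarith
  rw [vLow, if_pos (by linarith), Ue, Ue, mul_add, Real.exp_add, exp_mul_bLow hρ hΦ,
    add_sub_cancel_left]
  split_ifs <;> field_simp <;> ring

/-- Suppose ψ(Φ) = r + q for some Φ > 1 − ρ, where r, q > 0. Then the
jump-gap integral at the threshold b̲ satisfies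
f(b̲) = (e^{(1−ρ)b̲}/(1−ρ))·(r + q − ψ(1−ρ)) − (r+q)/(1−ρ) − ½σ²Φ. -/
theorem fGap_at_threshold_identity
    (ρ Φ μ σ r q : ℝ) (hρ : ρ ∈ Set.Ico (0 : ℝ) 1) (hΦ : 1 - ρ < Φ)
    (hσ : 0 ≤ σ) (hr : 0 < r) (hq : 0 < q)
    (ν : Measure ℝ)
    (hν : IntegrableOn (fun w => min 1 (w ^ 2)) (Set.Iio (0 : ℝ)) ν)
    (hψΦ : laplaceExponent μ σ ν Φ = r + q) :
    fGap ρ Φ ν (bLow ρ Φ) =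
      (Real.exp ((1 - ρ) * bLow ρ Φ) / (1 - ρ)) * (r + q - laplaceExponent μ σ ν (1 - ρ)) -
        (r + q) / (1 - ρ) - σ ^ 2 * Φ / 2 := by
  have ha : 1 - ρ ≠ 0 := by linarith [hρ.2]
  have hd : Φ - 1 + ρ ≠ 0 := by linarith
  have hiΦ := integrableOn_laplaceExponent_integrand hν (β := Φ) (by linarith [hρ.2])
  have hiρ := integrableOn_laplaceExponent_integrand hν (β := 1 - ρ) (by linarith [hρ.2])
  rw [fGap, setIntegral_congr_fun measurableSet_Iio
      fun w hw => vLow_sub_Ue_bLow_add hρ.2 hΦ hw,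
    integral_sub (hiΦ.const_mul _) (hiρ.const_mul _), integral_const_mul, integral_const_mul,
    exp_mul_bLow hρ.2 hΦ, ← hψΦ, laplaceExponent, laplaceExponent]
  field_simp
  ring
end

section
/- For ρ ∈ [0,1) and Λ > 1 − ρ, set z_c := (1/(1−ρ)) log(Λ/(Λ−1+ρ)). Then U(e^{s}) ≤ e^{−Λ(z_c − s)} U(e^{z_c}) for every s ≤ z_c, with strict inequality whenever s < z_c. (Equivalently, the ratio s ↦ U(e^{s}) / (e^{−Λ(z_c−s)} U(e^{z_c})) is strictly increasing on (−∞, z_c] and equals 1 at s = z_c.) -/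
open Real Set

theorem hasDerivAt_Ue {ρ : ℝ} (hρ : ρ < 1) (s : ℝ) :
    HasDerivAt (Ue ρ) (exp ((1 - ρ) * s)) s := by
  have ha : 1 - ρ ≠ 0 := (sub_pos.2 hρ).ne'
  refine ((((hasDerivAt_id s).const_mul (1 - ρ)).exp.sub_const 1).div_const (1 - ρ)).congr_deriv ?_
  simp only [id, mul_one]
  field_simp

theorem exp_mul_log_div_lt_iff {a Λ s : ℝ} (ha : 0 < a) (hΛ : a < Λ) :
    (Λ - a) * exp (a * s) < Λ ↔ s < (1 / a) * log (Λ / (Λ - a)) := by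
  have hd : 0 < Λ - a := sub_pos.2 hΛ
  rw [one_div_mul_eq_div, lt_div_iff₀' ha, lt_log_iff_exp_lt (div_pos (ha.trans hΛ) hd),
    lt_div_iff₀' hd]

theorem Ue_pos {ρ x : ℝ} (hρ : ρ < 1) (hx : 0 < x) : 0 < Ue ρ x :=
  div_pos (sub_pos.2 (one_lt_exp_iff.2 (mul_pos (sub_pos.2 hρ) hx))) (sub_pos.2 hρ)

/-- Discounting the utility at rate `Λ` leaves it strictly increasing up to the critical point. -/
theorem strictMonoOn_exp_mul_Ue {ρ Λ : ℝ} (hρ : ρ < 1) (hΛ : 1 - ρ < Λ) (z : ℝ) :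
    StrictMonoOn (fun s => exp (Λ * (z - s)) * Ue ρ s)
      (Iic ((1 / (1 - ρ)) * log (Λ / (Λ - (1 - ρ))))) := by
  have ha : 0 < 1 - ρ := sub_pos.2 hρ
  have hderiv (s : ℝ) : HasDerivAt (fun s => exp (Λ * (z - s)) * Ue ρ s)
      (exp (Λ * (z - s)) * ((Λ - (Λ - (1 - ρ)) * exp ((1 - ρ) * s)) / (1 - ρ))) s := by
    refine ((((hasDerivAt_id s).const_sub z).const_mul Λ).exp.mul
      (hasDerivAt_Ue hρ s)).congr_deriv ?_
    simp only [id, Ue]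
    field_simp
    ring
  refine strictMonoOn_of_deriv_pos (convex_Iic _)
    (fun s _ => (hderiv s).continuousAt.continuousWithinAt) fun s hs => ?_
  rw [interior_Iic, mem_Iio, ← exp_mul_log_div_lt_iff ha hΛ] at hs
  rw [(hderiv s).deriv]
  exact mul_pos (exp_pos _) (div_pos (sub_pos.2 hs) ha)

/-- For ρ ∈ [0,1) and Λ > 1 − ρ, set z_c := (1/(1−ρ)) log(Λ/(Λ−1+ρ)). Then
U(e^{s}) ≤ e^{−Λ(z_c − s)} U(e^{z_c}) for every s ≤ z_c, strictly whenever s < z_c.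
Equivalently, s ↦ U(e^{s}) / (e^{−Λ(z_c−s)} U(e^{z_c})) is strictly increasing on
(−∞, z_c] and equals 1 at s = z_c. -/
theorem utility_dominated_by_diagonal_value
    (ρ Λ : ℝ) (hρ : ρ ∈ Set.Ico (0 : ℝ) 1) (hΛ : 1 - ρ < Λ)
    (zc : ℝ) (hz : zc = (1 / (1 - ρ)) * Real.log (Λ / (Λ - 1 + ρ))) :
    (∀ s : ℝ, s ≤ zc → Ue ρ s ≤ Real.exp (-Λ * (zc - s)) * Ue ρ zc) ∧
    (∀ s : ℝ, s < zc → Ue ρ s < Real.exp (-Λ * (zc - s)) * Ue ρ zc) ∧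
    StrictMonoOn (fun s => Ue ρ s / (Real.exp (-Λ * (zc - s)) * Ue ρ zc))
      (Set.Iic zc) ∧
    Ue ρ zc / (Real.exp (-Λ * (zc - zc)) * Ue ρ zc) = 1 := by
  have ha : 0 < 1 - ρ := sub_pos.2 hρ.2
  have hsub : Λ - 1 + ρ = Λ - (1 - ρ) := by ring
  have hzc : 0 < zc := by
    rw [hz, hsub]
    refine (exp_mul_log_div_lt_iff ha hΛ).1 ?_
    simpa using hρ.2
  have hU : 0 < Ue ρ zc := Ue_pos hρ.2 hzc
  have hone : Ue ρ zc / (exp (-Λ * (zc - zc)) * Ue ρ zc) = 1 := by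
    simp [hU.ne']
  have hmono : StrictMonoOn (fun s => Ue ρ s / (exp (-Λ * (zc - s)) * Ue ρ zc)) (Iic zc) := by
    have hratio (s : ℝ) : Ue ρ s / (exp (-Λ * (zc - s)) * Ue ρ zc) =
        exp (Λ * (zc - s)) * Ue ρ s / Ue ρ zc := by
      rw [neg_mul, exp_neg]
      field_simp
    have h := strictMonoOn_exp_mul_Ue hρ.2 hΛ zc
    rw [← hsub, ← hz] at h
    intro s hs t ht hst
    simp only [hratio]
    exact div_lt_div_of_pos_right (h hs ht hst) hU
  have hlt (s : ℝ) (hs : s < zc) : Ue ρ s < exp (-Λ * (zc - s)) * Ue ρ zc := by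
    have h := hmono hs.le self_mem_Iic hs
    simp only [hone] at h
    exact (div_lt_one (mul_pos (exp_pos _) hU)).1 h
  refine ⟨fun s hs => ?_, hlt, hmono, hone⟩
  rcases hs.eq_or_lt with rfl | hs
  · simp
  · exact (hlt s hs).le
end
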